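/- arXiv:2506.13173 — 2 statements merged into one kernel-verified Lean document; each statement's English description precedes it below -/
import Mathlib

section
/- For every natural number α ≥ 1, α · Σ_{g=1}^{α+1} [ C(α+1, g−1) · (g−1)! · (2α+1−g)! ] + α! · (α+1)! = (2α+1)!, where C(n,k) denotes the binomial coefficient, 0! = 1 and C(n,0) = 1. -/
open Nat

/-- Telescoping identity for `n.descFactorial k * (n + a - k)!`. -/
theorem mul_sum_descFactorial_mul_factorial_add (n a m : ℕ) (hm : m ≤ n) :
    a * ∑ k ∈ Finset.range m, n.descFactorial k * (n + a - 1 - k)!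
      + n.descFactorial m * (n + a - m)! = (n + a)! := by
  induction m with
  | zero => simp
  | succ m ih =>
    rw [← ih (by omega), Finset.sum_range_succ, Nat.descFactorial_succ]
    obtain ⟨d, rfl⟩ := Nat.exists_eq_add_of_le hm
    have h₁ : m + 1 + d + a - 1 - m = d + a := by omega
    have h₂ : m + 1 + d + a - (m + 1) = d + a := by omega
    have h₃ : m + 1 + d + a - m = d + a + 1 := by omega
    have h₄ : m + 1 + d - m = d + 1 := by omega
    rw [h₁, h₂, h₃, h₄, Nat.factorial_succ (d + a)]
    ring

/-- Combinatorial identity of Lemma B.2 (used in the analysis of noisy ranking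
predictors): for every `α ≥ 1`,
`α · Σ_{g=1}^{α+1} C(α+1, g−1)·(g−1)!·(2α+1−g)! + α!·(α+1)! = (2α+1)!`. -/
theorem stmt11 (α : ℕ) (hα : 1 ≤ α) :
    α * ∑ g ∈ Finset.Icc 1 (α + 1),
        ((α + 1).choose (g - 1) * (g - 1)! * (2 * α + 1 - g)!)
      + α ! * (α + 1)! = (2 * α + 1)! := by
  have key := mul_sum_descFactorial_mul_factorial_add (α + 1) α (α + 1) le_rfl
  rw [Nat.descFactorial_self, Nat.add_sub_cancel_left, mul_comm (α + 1)!,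
    show α + 1 + α = 2 * α + 1 by ring] at key
  rw [← key, ← Finset.Ico_add_one_right_eq_Icc, Finset.sum_Ico_eq_sum_range]
  congr 2
  refine Finset.sum_congr (by simp) fun k _ => ?_
  rw [Nat.add_sub_cancel_left, Nat.descFactorial_eq_factorial_mul_choose,
    mul_comm ((α + 1).choose k), Nat.sub_sub]
end

section
/- Let α ≥ 1 be a natural number and let g ∈ {1, …, α+1}. The number of bijections π : {1,…,2α+1} → {1,…,2α+1} such that min{ π(i) : i ∈ {α+2, …, 2α+1} } = g equals α · C(α+1, g−1) · (g−1)! · (2α+1−g)!, where C(n,k) denotes the binomial coefficient. -/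
open Nat
open scoped Classical

/-- The number of permutations of `Fin n` sending the first `m` elements into a given set. -/
theorem card_perm_forall_lt_mem (m : ℕ) : ∀ (n : ℕ) (_ : m ≤ n) (P : Finset (Fin n)),
    (Finset.univ.filter (fun σ : Equiv.Perm (Fin n) => ∀ v : Fin n, (v : ℕ) < m → σ v ∈ P)).card
      = P.card.descFactorial m * (n - m)! := by
  induction m with
  | zero => intro n _ P; simp [Fintype.card_perm]
  | succ m ih =>
    rintro (_ | n) hmn P
    · omega
    let Q : Fin (n + 1) → Finset (Fin n) := fun p =>
      Finset.univ.filter (fun j => Equiv.swap 0 p j.succ ∈ P)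
    have hQ : ∀ p ∈ P, (Q p).card = P.card - 1 := by
      intro p hp
      rw [← Finset.card_erase_of_mem hp]
      refine Finset.card_bij (fun j _ => Equiv.swap 0 p j.succ) ?_ ?_ ?_
      · intro j hj
        refine Finset.mem_erase.2 ⟨fun h => ?_, (Finset.mem_filter.1 hj).2⟩
        rw [Equiv.swap_apply_eq_iff, Equiv.swap_apply_right] at h
        exact Fin.succ_ne_zero j h
      · intro a _ b _ h
        exact Fin.succ_injective _ ((Equiv.swap 0 p).injective h)
      · intro b hb
        obtain ⟨hbp, hbP⟩ := Finset.mem_erase.1 hb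
        have h0 : Equiv.swap 0 p b ≠ 0 := by
          rw [Ne, Equiv.swap_apply_eq_iff, Equiv.swap_apply_left]
          exact hbp
        obtain ⟨j, hj⟩ := Fin.exists_succ_eq.2 h0
        have hjb : Equiv.swap 0 p j.succ = b := by rw [hj, Equiv.swap_apply_self]
        exact ⟨j, by simpa [Q, hjb] using hbP, hjb⟩
    have hcard : (Finset.univ.filter (fun σ : Equiv.Perm (Fin (n + 1)) =>
          ∀ v : Fin (n + 1), (v : ℕ) < m + 1 → σ v ∈ P)).card
        = (P.sigma fun p => Finset.univ.filter (fun e : Equiv.Perm (Fin n) =>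
            ∀ v : Fin n, (v : ℕ) < m → e v ∈ Q p)).card := by
      refine Finset.card_equiv
        (Equiv.Perm.decomposeFin.trans (Equiv.sigmaEquivProd _ _).symm) fun σ => ?_
      obtain ⟨⟨p, e⟩, rfl⟩ := Equiv.Perm.decomposeFin.symm.surjective σ
      simp [Fin.forall_fin_succ, Q]
    rw [hcard, Finset.card_sigma,
      Finset.sum_congr rfl (fun p hp => by rw [ih n (by omega) (Q p), hQ p hp]),
      Finset.sum_const, smul_eq_mul, Nat.add_sub_add_right, ← mul_assoc]
    congr 1
    rcases P.card with _ | a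
    · simp
    · rw [Nat.succ_descFactorial_succ, Nat.add_sub_cancel]

/-- The minimum of the values at the positions from `a` on is `m + 1` iff the inverse permutation
sends everything below `m`, but not everything below `m + 1`, to positions before `a`. -/
theorem sInf_values_eq_succ_iff {n a m : ℕ} (ha : a < n)
    (π : Equiv.Perm (Fin n)) :
    sInf {k : ℕ | ∃ i : Fin n, a ≤ (i : ℕ) ∧ k = (π i : ℕ) + 1} = m + 1 ↔
      (∀ v : Fin n, (v : ℕ) < m → (π⁻¹ v : ℕ) < a) ∧
        ¬ ∀ v : Fin n, (v : ℕ) < m + 1 → (π⁻¹ v : ℕ) < a := by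
  set S := {k : ℕ | ∃ i : Fin n, a ≤ (i : ℕ) ∧ k = (π i : ℕ) + 1}
  have hS : S.Nonempty := ⟨_, ⟨a, ha⟩, le_rfl, rfl⟩
  constructor
  · intro h
    obtain ⟨i, hi, hik⟩ : m + 1 ∈ S := h ▸ Nat.sInf_mem hS
    refine ⟨fun v hv => ?_, fun hall => ?_⟩
    · by_contra hlt
      have hmem : (v : ℕ) + 1 ∈ S := ⟨π⁻¹ v, not_lt.1 hlt, by simp⟩
      have := Nat.sInf_le hmem
      omega
    · have := hall (π i) (by omega)
      simp only [Equiv.Perm.inv_def, Equiv.symm_apply_apply] at this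
      omega
  · rintro ⟨hlow, hex⟩
    push Not at hex
    obtain ⟨v, hv, hva⟩ := hex
    have hvm : (v : ℕ) = m := by
      by_contra hne
      have := hlow v (by omega)
      omega
    refine le_antisymm (Nat.sInf_le ⟨π⁻¹ v, hva, by simp [hvm]⟩) (le_csInf hS ?_)
    rintro k ⟨i, hi, rfl⟩
    by_contra hlt
    have := hlow (π i) (by omega)
    simp only [Equiv.Perm.inv_def, Equiv.symm_apply_apply] at this
    omega

/-- Counting claim underlying Lemma B.2: for `α ≥ 1` and `1 ≤ g ≤ α + 1`, the number of
permutations `π` of `{1,…,2α+1}` (modeled as `Equiv.Perm (Fin (2α+1))`, position/value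
`k ∈ {1,…,2α+1}` corresponding to `i : Fin (2α+1)` with `i.val + 1 = k`) such that the
minimum of the values taken at the last `α` positions `{α+2,…,2α+1}` equals `g`, is
`α · C(α+1, g−1) · (g−1)! · (2α+1−g)!`. -/
theorem stmt12 (α : ℕ) (hα : 1 ≤ α) (g : ℕ) (hg1 : 1 ≤ g) (hg2 : g ≤ α + 1) :
    (Finset.univ.filter (fun π : Equiv.Perm (Fin (2 * α + 1)) =>
        sInf {n : ℕ | ∃ i : Fin (2 * α + 1), α + 1 ≤ (i : ℕ) ∧ n = (π i : ℕ) + 1}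
          = g)).card
      = α * ((α + 1).choose (g - 1) * (g - 1)! * (2 * α + 1 - g)!) := by
  obtain ⟨m, rfl⟩ : ∃ m, g = m + 1 := ⟨g - 1, by omega⟩
  let P : Finset (Fin (2 * α + 1)) := Finset.univ.filter (fun i => (i : ℕ) < α + 1)
  have hP : P.card = α + 1 := by
    rw [Fin.card_filter_val_lt]
    omega
  let A : ℕ → Finset (Equiv.Perm (Fin (2 * α + 1))) := fun k =>
    Finset.univ.filter (fun σ => ∀ v : Fin (2 * α + 1), (v : ℕ) < k → σ v ∈ P)
  have hA : ∀ k ≤ 2 * α + 1, (A k).card = (α + 1).descFactorial k * (2 * α + 1 - k)! :=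
    fun k hk => by rw [card_perm_forall_lt_mem k _ hk P, hP]
  have hsub : A (m + 1) ⊆ A m := fun σ hσ =>
    Finset.mem_filter.2 ⟨Finset.mem_univ _, fun v hv =>
      (Finset.mem_filter.1 hσ).2 v (Nat.lt_succ_of_lt hv)⟩
  have hcard : (Finset.univ.filter (fun π : Equiv.Perm (Fin (2 * α + 1)) =>
      sInf {n : ℕ | ∃ i : Fin (2 * α + 1), α + 1 ≤ (i : ℕ) ∧ n = (π i : ℕ) + 1}
        = m + 1)).card = (A m \ A (m + 1)).card := by
    refine Finset.card_equiv (Equiv.inv _) fun π => ?_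
    rw [Finset.mem_filter, sInf_values_eq_succ_iff (by omega)]
    simp [A, P]
  rw [hcard, Finset.card_sdiff_of_subset hsub, hA m (by omega), hA (m + 1) (by omega),
    Nat.add_sub_cancel, mul_comm ((α + 1).choose m), ← Nat.descFactorial_eq_factorial_mul_choose,
    Nat.descFactorial_succ]
  obtain ⟨d, rfl⟩ : ∃ d, α = m + d := ⟨α - m, by omega⟩
  rw [show 2 * (m + d) + 1 - m = (m + 2 * d) + 1 by omega,
    show 2 * (m + d) + 1 - (m + 1) = m + 2 * d by omega,
    show m + d + 1 - m = d + 1 by omega, Nat.factorial_succ]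
  apply Nat.sub_eq_of_eq_add
  ring
end
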